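/- arXiv:2506.23911 — 4 statements merged into one kernel-verified Lean document; each statement's English description precedes it below -/
import Mathlib

section
/- Let ⟨-,-⟩_R and ⟨-,-⟩_S be nondegenerate bilinear forms on R and S respectively, and let B be a t-twisted product form on R ⊗_k S. Then B is nondegenerate: if B(x, y) = 0 for all y ∈ R ⊗_k S then x = 0, and if B(y, x) = 0 for all y ∈ R ⊗_k S then x = 0. -/
open scoped TensorProduct

/-- Linear maps agreeing on a spanning family of submodules are equal. -/
theorem LinearMap.ext_of_iSup_eq_top {k ι M N : Type*} [Semiring k] [AddCommMonoid M] [Module k M]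
    [AddCommMonoid N] [Module k N] {p : ι → Submodule k M} (hp : iSup p = ⊤)
    {f g : M →ₗ[k] N} (h : ∀ i, ∀ m ∈ p i, f m = g m) : f = g := by
  have hle : iSup p ≤ LinearMap.eqLocus f g := iSup_le fun i m hm => h i m hm
  ext m
  exact hle (hp ▸ Submodule.mem_top)

/-- Rescaling each summand of an internal direct sum by a unit is a linear automorphism. -/
theorem DirectSum.IsInternal.exists_linearEquiv_smul {k ι M : Type*} [CommRing k] [DecidableEq ι]
    [AddCommGroup M] [Module k M] {p : ι → Submodule k M} (hp : DirectSum.IsInternal p)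
    (c : ι → kˣ) : ∃ T : M ≃ₗ[k] M, ∀ i, ∀ m ∈ p i, T m = (c i : k) • m := by
  let e : DirectSum ι (fun i => p i) ≃ₗ[k] M :=
    LinearEquiv.ofBijective (DirectSum.coeLinearMap p) hp
  have he (i : ι) (m : p i) : e (DirectSum.lof k ι (fun i => p i) i m) = m :=
    DirectSum.coeLinearMap_lof p i m
  refine ⟨e.symm ≪≫ₗ (DFinsupp.mapRange.linearEquiv
    fun i => LinearEquiv.smulOfUnit (M := p i) (c i)) ≪≫ₗ e, fun i m hm => ?_⟩
  have hs : e.symm m = DirectSum.lof k ι (fun i => p i) i ⟨m, hm⟩ := by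
    rw [LinearEquiv.symm_apply_eq, he]
  have hmap : (DFinsupp.mapRange.linearEquiv fun i => LinearEquiv.smulOfUnit (M := p i) (c i))
      (DirectSum.lof k ι (fun i => p i) i ⟨m, hm⟩) =
      DirectSum.lof k ι (fun i => p i) i ((c i : k) • ⟨m, hm⟩) :=
    DFinsupp.mapRange_single (hf := fun i => map_zero (LinearEquiv.smulOfUnit (M := p i) (c i)))
  rw [LinearEquiv.trans_apply, LinearEquiv.trans_apply, hs, hmap, he]
  rfl

/-- A family of functionals separating the points of `R` separates the points of `R ⊗[k] S`
after tensoring with a free module `S`. -/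
theorem TensorProduct.eq_zero_of_forall_rTensor_eq_zero {k R S W : Type*} [CommRing k]
    [AddCommGroup R] [Module k R] [AddCommGroup S] [Module k S] [Module.Free k S]
    (Ψ : W → R →ₗ[k] k) (hΨ : ∀ v, (∀ w, Ψ w v = 0) → v = 0) (x : R ⊗[k] S)
    (hx : ∀ w, (Ψ w).rTensor S x = 0) : x = 0 := by
  let b := Module.Free.chooseBasis k S
  have key (w : W) (i) (y : R ⊗[k] S) :
      Ψ w (TensorProduct.equivFinsuppOfBasisRight b y i) =
        b.repr (TensorProduct.lid k S ((Ψ w).rTensor S y)) i := by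
    induction y with
    | zero => simp
    | tmul r s => simp [mul_comm]
    | add y z hy hz => simp [hy, hz]
  apply (TensorProduct.equivFinsuppOfBasisRight (M := R) b).injective
  ext i
  rw [map_zero, Finsupp.zero_apply]
  refine hΨ _ fun w => ?_
  rw [key, hx, map_zero, map_zero, Finsupp.zero_apply]

/-- A twisted product of separating forms is left separating, where the twist may be any
family of units. -/
theorem twisted_product_form_separatingLeft {k A B R S : Type*} [CommRing k] [DecidableEq B]
    [AddCommGroup R] [Module k R] [AddCommGroup S] [Module k S] [Module.Free k S]
    {𝒜 : A → Submodule k R} {ℬ : B → Submodule k S}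
    (h𝒜 : iSup 𝒜 = ⊤) (hℬ : DirectSum.IsInternal ℬ) (c : A → B → kˣ)
    (ΦR : R →ₗ[k] R →ₗ[k] k) (ΦS : S →ₗ[k] S →ₗ[k] k)
    (hΦR : ∀ v, (∀ w, ΦR v w = 0) → v = 0) (hΦS : ∀ v, (∀ w, ΦS v w = 0) → v = 0)
    (F : (R ⊗[k] S) →ₗ[k] (R ⊗[k] S) →ₗ[k] k)
    (hF : ∀ (a a' : A) (b b' : B) (r r' : R) (s s' : S),
      r ∈ 𝒜 a → r' ∈ 𝒜 a' → s ∈ ℬ b → s' ∈ ℬ b' →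
      F (r ⊗ₜ[k] s) (r' ⊗ₜ[k] s') = (c a' b : k) * (ΦR r r' * ΦS s s'))
    (x : R ⊗[k] S) (hx : ∀ y, F x y = 0) : x = 0 := by
  refine TensorProduct.eq_zero_of_forall_rTensor_eq_zero ΦR.flip hΦR x fun r' => ?_
  suffices h : (LinearMap.rTensorHom S ∘ₗ ΦR.flip).flip x = 0 from LinearMap.congr_fun h r'
  refine LinearMap.ext_of_iSup_eq_top h𝒜 fun a' r' hr' => ?_
  obtain ⟨T, hT⟩ := hℬ.exists_linearEquiv_smul (c a')
  have hFT (s' : S) : F.flip (r' ⊗ₜ[k] s') =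
      ΦS.flip s' ∘ₗ T.toLinearMap ∘ₗ (TensorProduct.lid k S).toLinearMap ∘ₗ
        (ΦR.flip r').rTensor S := by
    refine TensorProduct.ext' fun r s => ?_
    suffices h : F (r ⊗ₜ[k] s) ∘ₗ TensorProduct.mk k R S r' = ΦR r r' • ΦS (T s) by
      simpa using LinearMap.congr_fun h s'
    refine LinearMap.ext_of_iSup_eq_top hℬ.submodule_iSup_eq_top fun b' s' hs' => ?_
    suffices h : F.flip (r' ⊗ₜ[k] s') ∘ₗ TensorProduct.mk k R S r =
        ΦR r r' • (ΦS.flip s' ∘ₗ T.toLinearMap) by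
      simpa using LinearMap.congr_fun h s
    refine LinearMap.ext_of_iSup_eq_top hℬ.submodule_iSup_eq_top fun b s hs => ?_
    suffices h : F.flip (r' ⊗ₜ[k] s') ∘ₗ (TensorProduct.mk k R S).flip s =
        ΦS (T s) s' • ΦR.flip r' by
      simpa [mul_comm] using LinearMap.congr_fun h r
    refine LinearMap.ext_of_iSup_eq_top h𝒜 fun a r hr => ?_
    simp [hF a a' b b' r r' s s' hr hr' hs hs', hT b s hs, mul_comm, mul_left_comm]
  have hz : T (TensorProduct.lid k S ((ΦR.flip r').rTensor S x)) = 0 :=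
    hΦS _ fun s' => (LinearMap.congr_fun (hFT s') x).symm.trans (hx _)
  simpa using hz

/-- A `t`-twisted product form on `R ⊗[k] S` built from nondegenerate
bilinear forms on `R` and `S` is nondegenerate. -/
theorem twisted_product_form_nondegenerate
    (k : Type*) [Field k]
    (A B : Type*) [AddCommGroup A] [AddCommGroup B] [DecidableEq A] [DecidableEq B]
    (R S : Type*) [AddCommGroup R] [Module k R] [AddCommGroup S] [Module k S]
    [FiniteDimensional k R] [FiniteDimensional k S]
    (𝒜 : A → Submodule k R) (ℬ : B → Submodule k S)
    (hRgr : DirectSum.IsInternal 𝒜) (hSgr : DirectSum.IsInternal ℬ)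
    (t : A → B → kˣ)
    (ht1 : ∀ a a' b, t (a + a') b = t a b * t a' b)
    (ht2 : ∀ a b b', t a (b + b') = t a b * t a b')
    (ΦR : R →ₗ[k] R →ₗ[k] k) (ΦS : S →ₗ[k] S →ₗ[k] k)
    (hΦR₁ : ∀ v : R, (∀ w, ΦR v w = 0) → v = 0)
    (hΦR₂ : ∀ v : R, (∀ w, ΦR w v = 0) → v = 0)
    (hΦS₁ : ∀ v : S, (∀ w, ΦS v w = 0) → v = 0)
    (hΦS₂ : ∀ v : S, (∀ w, ΦS w v = 0) → v = 0)
    (Bf : (R ⊗[k] S) →ₗ[k] (R ⊗[k] S) →ₗ[k] k)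
    (hBf : ∀ (a a' : A) (b b' : B) (r r' : R) (s s' : S),
      r ∈ 𝒜 a → r' ∈ 𝒜 a' → s ∈ ℬ b → s' ∈ ℬ b' →
      Bf (r ⊗ₜ[k] s) (r' ⊗ₜ[k] s') = (t a' b : k) * (ΦR r r' * ΦS s s')) :
    (∀ x : R ⊗[k] S, (∀ y, Bf x y = 0) → x = 0) ∧
    (∀ x : R ⊗[k] S, (∀ y, Bf y x = 0) → x = 0) := by
  refine ⟨twisted_product_form_separatingLeft hRgr.submodule_iSup_eq_top hSgr t ΦR ΦS
    hΦR₁ hΦS₁ Bf hBf, fun x hx => ?_⟩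
  let e := TensorProduct.comm k S R
  have h := twisted_product_form_separatingLeft hSgr.submodule_iSup_eq_top hRgr
    (fun b a => t a b) ΦS.flip ΦR.flip hΦS₂ hΦR₂
    (Bf.compl₁₂ e.toLinearMap e.toLinearMap).flip
    (fun b b' a a' s s' r r' hs hs' hr hr' => by
      simp [e, hBf a' a b' b r' r s' s hr' hr hs' hs, mul_comm]) (e.symm x)
    (fun y => by simpa using hx (e y))
  simpa using h
end

section
/- Suppose R is an A-graded k-algebra and S is a B-graded k-algebra, ⟨-,-⟩_R and ⟨-,-⟩_S are invariant bilinear forms, and B is a t-twisted product form on R ⊗_k S. Then for all homogeneous a ∈ R^α, c ∈ R^γ, e ∈ R^ε and b ∈ S^β, d ∈ S^δ, f ∈ S^φ one has t(γ,β)·B((a·c)⊗(b·d), e⊗f) = t(ε,δ)·B(a⊗b, (c·e)⊗(d·f)). (This is the Frobenius invariance of B with respect to the twisted multiplication (r⊗s)·(r'⊗s') = t(a',b)·(rr')⊗(ss') on homogeneous elements.) -/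
open scoped TensorProduct

/-- Frobenius invariance of the twisted product form with respect to the
twisted multiplication on `R ⊗[k] S`. -/
theorem twisted_product_form_invariance
    (k : Type*) [Field k]
    (A B : Type*) [AddCommGroup A] [AddCommGroup B] [DecidableEq A] [DecidableEq B]
    (R S : Type*) [Ring R] [Algebra k R] [Ring S] [Algebra k S]
    [FiniteDimensional k R] [FiniteDimensional k S]
    (𝒜 : A → Submodule k R) (ℬ : B → Submodule k S)
    (hRgr : DirectSum.IsInternal 𝒜) (hSgr : DirectSum.IsInternal ℬ)
    (hRmul : ∀ (a a' : A) (r r' : R), r ∈ 𝒜 a → r' ∈ 𝒜 a' → r * r' ∈ 𝒜 (a + a'))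
    (hRone : (1 : R) ∈ 𝒜 0)
    (hSmul : ∀ (b b' : B) (s s' : S), s ∈ ℬ b → s' ∈ ℬ b' → s * s' ∈ ℬ (b + b'))
    (hSone : (1 : S) ∈ ℬ 0)
    (t : A → B → kˣ)
    (ht1 : ∀ a a' b, t (a + a') b = t a b * t a' b)
    (ht2 : ∀ a b b', t a (b + b') = t a b * t a b')
    (ΦR : R →ₗ[k] R →ₗ[k] k) (ΦS : S →ₗ[k] S →ₗ[k] k)
    (hΦRinv : ∀ x y z : R, ΦR (x * y) z = ΦR x (y * z))
    (hΦSinv : ∀ x y z : S, ΦS (x * y) z = ΦS x (y * z))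
    (Bf : (R ⊗[k] S) →ₗ[k] (R ⊗[k] S) →ₗ[k] k)
    (hBf : ∀ (a a' : A) (b b' : B) (r r' : R) (s s' : S),
      r ∈ 𝒜 a → r' ∈ 𝒜 a' → s ∈ ℬ b → s' ∈ ℬ b' →
      Bf (r ⊗ₜ[k] s) (r' ⊗ₜ[k] s') = (t a' b : k) * (ΦR r r' * ΦS s s')) :
    ∀ (α γ ε : A) (β δ φ : B) (a c e : R) (b d f : S),
      a ∈ 𝒜 α → c ∈ 𝒜 γ → e ∈ 𝒜 ε → b ∈ ℬ β → d ∈ ℬ δ → f ∈ ℬ φ →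
      (t γ β : k) * Bf ((a * c) ⊗ₜ[k] (b * d)) (e ⊗ₜ[k] f) =
        (t ε δ : k) * Bf (a ⊗ₜ[k] b) ((c * e) ⊗ₜ[k] (d * f)) := by
  intro α γ ε β δ φ a c e b d f ha hc he hb hd hf
  rw [hBf (α + γ) ε (β + δ) φ _ _ _ _ (hRmul α γ a c ha hc) he (hSmul β δ b d hb hd) hf,
    hBf α (γ + ε) β (δ + φ) _ _ _ _ ha (hRmul γ ε c e hc he) hb (hSmul δ φ d f hd hf),
    ht1, ht2, hΦRinv, hΦSinv, Units.val_mul, Units.val_mul]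
  ring
end

section
/- Suppose R is an A-graded k-algebra and S is a B-graded k-algebra, ⟨-,-⟩_R and ⟨-,-⟩_S are nondegenerate invariant bilinear forms graded with shifts σ_R and σ_S respectively, ν_R and ν_S are Nakayama automorphisms for ⟨-,-⟩_R and ⟨-,-⟩_S, and B is a t-twisted product form on R ⊗_k S. Then for all homogeneous a ∈ R^α, b ∈ S^β and every y ∈ R ⊗_k S: B(a⊗b, y) = t(α, σ_S)·t(σ_R, β)⁻¹·B(y, ν_R(a) ⊗ ν_S(b)). (Consequently the Nakayama automorphism ν of the twisted tensor product satisfies ν(a⊗b) = t(α,σ_S)·t(σ_R,β)⁻¹·ν_R(a)⊗ν_S(b) on homogeneous elements.) -/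
open scoped TensorProduct

theorem DirectSum.IsInternal.induction_on {k ι M : Type*} [DecidableEq ι] [Ring k]
    [AddCommGroup M] [Module k M] {ℳ : ι → Submodule k M} (h : DirectSum.IsInternal ℳ)
    {p : M → Prop} (hom : ∀ i, ∀ x ∈ ℳ i, p x) (zero : p 0)
    (add : ∀ x y, p x → p y → p (x + y)) (x : M) : p x :=
  Submodule.iSup_induction ℳ (motive := p) (h.submodule_iSup_eq_top ▸ Submodule.mem_top) hom zero add

/-- A twisted product form whose left argument is homogeneous only sees the components of its
right argument in the complementary degree, so there the twist is a single scalar. -/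
theorem twisted_form_apply_of_left_homogeneous
    {k A B R S : Type*} [Field k] [AddCommGroup A] [DecidableEq A] [DecidableEq B]
    [AddCommGroup R] [Module k R] [AddCommGroup S] [Module k S]
    {𝒜 : A → Submodule k R} {ℬ : B → Submodule k S}
    (hRgr : DirectSum.IsInternal 𝒜) (hSgr : DirectSum.IsInternal ℬ) {t : A → B → kˣ}
    {ΦR : R →ₗ[k] R →ₗ[k] k} {ΦS : S →ₗ[k] S →ₗ[k] k} {σR : A}
    (hgrR : ∀ (a a' : A) (r r' : R), r ∈ 𝒜 a → r' ∈ 𝒜 a' →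
      ΦR r r' ≠ 0 → a + a' + σR = 0)
    {Bf : (R ⊗[k] S) →ₗ[k] (R ⊗[k] S) →ₗ[k] k}
    (hBf : ∀ (a a' : A) (b b' : B) (r r' : R) (s s' : S),
      r ∈ 𝒜 a → r' ∈ 𝒜 a' → s ∈ ℬ b → s' ∈ ℬ b' →
      Bf (r ⊗ₜ[k] s) (r' ⊗ₜ[k] s') = (t a' b : k) * (ΦR r r' * ΦS s s'))
    {a c : A} {b : B} {r : R} {s : S} (hr : r ∈ 𝒜 a) (hs : s ∈ ℬ b)
    (hc : a + c + σR = 0) (z : R) (w : S) :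
    Bf (r ⊗ₜ[k] s) (z ⊗ₜ[k] w) = (t c b : k) * (ΦR r z * ΦS s w) := by
  induction z using hRgr.induction_on with
  | hom i z hz =>
    induction w using hSgr.induction_on with
    | hom j w hw =>
      rw [hBf a i b j r z s w hr hz hs hw]
      by_cases h : ΦR r z = 0
      · simp [h]
      · have hi : i = c := by
          have := (hgrR a i r z hr hz h).trans hc.symm
          simpa using this
        rw [hi]
    | zero => simp
    | add x y hx hy => rw [TensorProduct.tmul_add, map_add, hx, hy, map_add]; ring
  | zero => simp
  | add x y hx hy =>
    rw [TensorProduct.add_tmul, map_add, hx, hy, map_add]; ring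

/-- The Nakayama automorphism of the twisted tensor product:
`B(a⊗b, y) = t(α,σ_S)·t(σ_R,β)⁻¹·B(y, ν_R(a) ⊗ ν_S(b))` for homogeneous `a`, `b`. -/
theorem twisted_tensor_nakayama
    (k : Type*) [Field k]
    (A B : Type*) [AddCommGroup A] [AddCommGroup B] [DecidableEq A] [DecidableEq B]
    (R S : Type*) [Ring R] [Algebra k R] [Ring S] [Algebra k S]
    [FiniteDimensional k R] [FiniteDimensional k S]
    (𝒜 : A → Submodule k R) (ℬ : B → Submodule k S)
    (hRgr : DirectSum.IsInternal 𝒜) (hSgr : DirectSum.IsInternal ℬ)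
    (hRmul : ∀ (a a' : A) (r r' : R), r ∈ 𝒜 a → r' ∈ 𝒜 a' → r * r' ∈ 𝒜 (a + a'))
    (hRone : (1 : R) ∈ 𝒜 0)
    (hSmul : ∀ (b b' : B) (s s' : S), s ∈ ℬ b → s' ∈ ℬ b' → s * s' ∈ ℬ (b + b'))
    (hSone : (1 : S) ∈ ℬ 0)
    (t : A → B → kˣ)
    (ht1 : ∀ a a' b, t (a + a') b = t a b * t a' b)
    (ht2 : ∀ a b b', t a (b + b') = t a b * t a b')
    (ΦR : R →ₗ[k] R →ₗ[k] k) (ΦS : S →ₗ[k] S →ₗ[k] k)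
    (hΦRinv : ∀ x y z : R, ΦR (x * y) z = ΦR x (y * z))
    (hΦSinv : ∀ x y z : S, ΦS (x * y) z = ΦS x (y * z))
    (hΦR₁ : ∀ v : R, (∀ w, ΦR v w = 0) → v = 0)
    (hΦR₂ : ∀ v : R, (∀ w, ΦR w v = 0) → v = 0)
    (hΦS₁ : ∀ v : S, (∀ w, ΦS v w = 0) → v = 0)
    (hΦS₂ : ∀ v : S, (∀ w, ΦS w v = 0) → v = 0)
    (σR : A) (σS : B)
    (hgrR : ∀ (a a' : A) (r r' : R), r ∈ 𝒜 a → r' ∈ 𝒜 a' →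
      ΦR r r' ≠ 0 → a + a' + σR = 0)
    (hgrS : ∀ (b b' : B) (s s' : S), s ∈ ℬ b → s' ∈ ℬ b' →
      ΦS s s' ≠ 0 → b + b' + σS = 0)
    (νR : R →ₗ[k] R) (hνR : ∀ a x : R, ΦR a x = ΦR x (νR a))
    (νS : S →ₗ[k] S) (hνS : ∀ b x : S, ΦS b x = ΦS x (νS b))
    (Bf : (R ⊗[k] S) →ₗ[k] (R ⊗[k] S) →ₗ[k] k)
    (hBf : ∀ (a a' : A) (b b' : B) (r r' : R) (s s' : S),
      r ∈ 𝒜 a → r' ∈ 𝒜 a' → s ∈ ℬ b → s' ∈ ℬ b' →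
      Bf (r ⊗ₜ[k] s) (r' ⊗ₜ[k] s') = (t a' b : k) * (ΦR r r' * ΦS s s')) :
    ∀ (α : A) (β : B) (a : R) (b : S), a ∈ 𝒜 α → b ∈ ℬ β →
      ∀ y : R ⊗[k] S,
        Bf (a ⊗ₜ[k] b) y =
          (t α σS : k) * (((t σR β)⁻¹ : kˣ) : k) * Bf y (νR a ⊗ₜ[k] νS b) := by
  intro α β a b ha hb y
  induction y using TensorProduct.induction_on with
  | zero => simp
  | add x y hx hy => rw [map_add, hx, hy, map_add, LinearMap.add_apply]; ring
  | tmul r s =>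
    induction r using hRgr.induction_on with
    | zero => simp
    | add x y hx hy =>
      rw [TensorProduct.add_tmul, map_add, hx, hy, map_add, LinearMap.add_apply]; ring
    | hom i r hr =>
      induction s using hSgr.induction_on with
      | zero => simp
      | add x y hx hy =>
        rw [TensorProduct.tmul_add, map_add, hx, hy, map_add, LinearMap.add_apply]; ring
      | hom j s hs =>
        rw [hBf α i β j a r b s ha hr hb hs]
        by_cases hR : ΦR a r = 0
        · rw [twisted_form_apply_of_left_homogeneous hRgr hSgr hgrR hBf hr hs
            (c := -i - σR) (by abel), ← hνR, hR]
          simp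
        have hi := hgrR α i a r ha hr hR
        rw [twisted_form_apply_of_left_homogeneous hRgr hSgr hgrR hBf hr hs
          (c := α) (by rw [← hi]; abel), ← hνR, ← hνS]
        by_cases hS : ΦS b s = 0
        · simp [hS]
        have hj := hgrS β j b s hb hs hS
        have h0l : t 0 β = 1 := by simpa using ht1 0 0 β
        have h0r : t α 0 = 1 := by simpa using ht2 α 0 0
        rw [← hi, ht1, ht1] at h0l
        rw [← hj, ht2, ht2] at h0r
        have key : t i β = t α σS * (t σR β)⁻¹ * t α j := by
          have h : t i β * t σR β = t α j * t α σS :=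
            mul_left_cancel (a := t α β) (by rw [← mul_assoc, ← mul_assoc, h0l, h0r])
          rw [eq_mul_inv_of_mul_eq h, mul_comm (t α j), mul_right_comm]
        rw [key]
        push_cast
        ring
end

section
/- Let R be a finite-dimensional A-graded k-algebra with a nondegenerate invariant bilinear form ⟨-,-⟩_R graded with shift σ_R, let ν : R → R be a Nakayama automorphism for ⟨-,-⟩_R, let t : A × B → kˣ be a bicharacter, and fix b ∈ B. Let φ : R → Dual_k(R) be the linear map determined on homogeneous r ∈ R^a by φ(r) = t(a,b)⁻¹·⟨r, -⟩_R. Then φ is bijective, and for all homogeneous x ∈ R^α and all r, y ∈ R: φ(x·r)(y) = t(α,b)⁻¹·φ(r)(y·ν(x)) and t(α,b)·φ(r·x)(y) = φ(r)(x·y). (This realizes the bimodule isomorphism R_{b̂} ≅ D(R_{ν·b̂⁻¹}), where b̂ denotes the grading automorphism acting on R^a by the scalar t(a,b).) -/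
/-- The bimodule isomorphism `R_{b̂} ≅ D(R_{ν·b̂⁻¹})`:
the map `φ(r) = t(a,b)⁻¹·⟨r,-⟩` (on homogeneous `r` of degree `a`) is bijective and
satisfies `φ(x·r)(y) = t(α,b)⁻¹·φ(r)(y·ν(x))` and `t(α,b)·φ(r·x)(y) = φ(r)(x·y)`. -/
theorem twisted_dual_bimodule_iso
    (k : Type*) [Field k]
    (A B : Type*) [AddCommGroup A] [AddCommGroup B] [DecidableEq A]
    (R : Type*) [Ring R] [Algebra k R] [FiniteDimensional k R]
    (𝒜 : A → Submodule k R)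
    (hRgr : DirectSum.IsInternal 𝒜)
    (hRmul : ∀ (a a' : A) (r r' : R), r ∈ 𝒜 a → r' ∈ 𝒜 a' → r * r' ∈ 𝒜 (a + a'))
    (hRone : (1 : R) ∈ 𝒜 0)
    (Φ : R →ₗ[k] R →ₗ[k] k)
    (hinv : ∀ x y z : R, Φ (x * y) z = Φ x (y * z))
    (hΦ₁ : ∀ v : R, (∀ w, Φ v w = 0) → v = 0)
    (hΦ₂ : ∀ v : R, (∀ w, Φ w v = 0) → v = 0)
    (σR : A)
    (hgr : ∀ (a a' : A) (r r' : R), r ∈ 𝒜 a → r' ∈ 𝒜 a' →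
      Φ r r' ≠ 0 → a + a' + σR = 0)
    (ν : R →ₗ[k] R)
    (hν : ∀ a x : R, Φ a x = Φ x (ν a))
    (t : A → B → kˣ)
    (ht1 : ∀ a a' b, t (a + a') b = t a b * t a' b)
    (ht2 : ∀ a b b', t a (b + b') = t a b * t a b')
    (b : B)
    (φ : R →ₗ[k] Module.Dual k R)
    (hφ : ∀ (a : A) (r : R), r ∈ 𝒜 a → φ r = (((t a b)⁻¹ : kˣ) : k) • Φ r) :
    Function.Bijective φ ∧
    ∀ (α : A) (x : R), x ∈ 𝒜 α → ∀ r y : R,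
      φ (x * r) y = (((t α b)⁻¹ : kˣ) : k) * φ r (y * ν x) ∧
      (t α b : k) * φ (r * x) y = φ r (x * y) := by
  have hind : ∀ {p : R → Prop}, (∀ a, ∀ r ∈ 𝒜 a, p r) → p 0 →
      (∀ r s, p r → p s → p (r + s)) → ∀ r, p r := fun {p} h h0 hadd r =>
    Submodule.iSup_induction 𝒜 (motive := p)
      (hRgr.submodule_iSup_eq_top ▸ Submodule.mem_top : r ∈ iSup 𝒜) h h0 hadd
  have hdim : Module.finrank k R = Module.finrank k (Module.Dual k R) :=
    Subspace.dual_finrank_eq.symm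
  refine ⟨?_, fun α x hx r y => ?_⟩
  · have hΦinj : Function.Injective Φ := (injective_iff_map_eq_zero Φ).2 fun v hv =>
      hΦ₁ v fun w => by rw [hv, LinearMap.zero_apply]
    have hΦsurj : Function.Surjective Φ :=
      (LinearMap.injective_iff_surjective_of_finrank_eq_finrank hdim).1 hΦinj
    have hmem : ∀ r, Φ r ∈ LinearMap.range φ := by
      refine hind (fun a r hr => ⟨(t a b : k) • r, ?_⟩) ?_ fun r s hr hs => ?_
      · rw [map_smul, hφ a r hr, smul_smul, Units.mul_inv, one_smul]
      · rw [map_zero]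
        exact zero_mem _
      · rw [map_add]
        exact add_mem hr hs
    have hsurj : Function.Surjective φ := fun f => by
      obtain ⟨r, rfl⟩ := hΦsurj f
      exact hmem r
    exact ⟨(LinearMap.injective_iff_surjective_of_finrank_eq_finrank hdim).2 hsurj, hsurj⟩
  · refine hind (p := fun r => φ (x * r) y = (((t α b)⁻¹ : kˣ) : k) * φ r (y * ν x) ∧
      (t α b : k) * φ (r * x) y = φ r (x * y)) (fun a r hr => ⟨?_, ?_⟩) (by simp) ?_ r
    · rw [hφ _ _ (hRmul _ _ _ _ hx hr), hφ a r hr, ht1]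
      simp only [LinearMap.smul_apply, smul_eq_mul]
      rw [hinv x r y, hν x (r * y), hinv r y, mul_inv, Units.val_mul, mul_assoc]
    · rw [hφ _ _ (hRmul _ _ _ _ hr hx), hφ a r hr, ht1]
      simp only [LinearMap.smul_apply, smul_eq_mul]
      rw [hinv r x y, mul_inv_rev, Units.val_mul, mul_assoc, Units.mul_inv_cancel_left]
    · rintro r s ⟨hr₁, hr₂⟩ ⟨hs₁, hs₂⟩
      simp only [mul_add, add_mul, map_add, LinearMap.add_apply, hr₁, hr₂, hs₁, hs₂, and_self]
end
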